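/- With a fair coin (p = 1/2), in the game between S₁ = TTTHTTT and S₂ = TTHTTTTHT, the probability that S₁ wins is exactly 62/71 and the probability that S₂ wins is exactly 9/71. -/

import Mathlib

open MeasureTheory ENNReal

def occursAt (S : List Bool) (ω : ℕ → Bool) (n : ℕ) : Prop :=
  S.length ≤ n ∧ ∀ j < S.length, ω (n - S.length + j) = S.getD j false

/-- In the game between `S₁` and `S₂`, `S₁` wins: it occurs ending at some trial `n`
while neither pattern occurs ending at any earlier trial. -/
def winsGame (S₁ S₂ : List Bool) (ω : ℕ → Bool) : Prop :=
  ∃ n, occursAt S₁ ω n ∧ ∀ l < n, ¬ occursAt S₁ ω l ∧ ¬ occursAt S₂ ω l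

section PatternGame

variable {ι : Type*}

/-- Pattern `i` of the family `S` occurs at time `k`, and no pattern occurs earlier. -/
def firstAt (S : ι → List Bool) (i : ι) (k : ℕ) : Set (ℕ → Bool) :=
  {ω | occursAt (S i) ω k ∧ ∀ l < k, ∀ i', ¬ occursAt (S i') ω l}

/-- No pattern of the family `S` occurs up to time `n`. -/
def survives (S : ι → List Bool) (n : ℕ) : Set (ℕ → Bool) :=
  {ω | ∀ l ≤ n, ∀ i, ¬ occursAt (S i) ω l}

/-- The word `b` of length `m` is read immediately after time `n`. -/
def readsAfter (n m : ℕ) (b : ℕ → Bool) : Set (ℕ → Bool) :=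
  {ω | ∀ j < m, ω (n + j) = b j}

/-- The first `j` letters of `S` are the last `j` letters of `T`. -/
def Overlaps (S T : List Bool) (j : ℕ) : Prop :=
  j ≤ T.length ∧ ∀ r < j, S.getD r false = T.getD (T.length - j + r) false

instance (S T : List Bool) (j : ℕ) : Decidable (Overlaps S T j) := by
  unfold Overlaps; infer_instance

instance (S : List Bool) (ω : ℕ → Bool) (n : ℕ) : Decidable (occursAt S ω n) := by
  unfold occursAt; infer_instance

/-- Conway's leading number, up to normalization. -/
def overlapWeight (S T : List Bool) : ℕ :=
  ∑ j ∈ Finset.range S.length, if Overlaps S T (j + 1) then 2 ^ (j + 1) else 0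

/-- The letters of a list, continued by `false`. -/
def letters (S : List Bool) (n : ℕ) : Bool := S.getD n false

/-- Membership in `B` depends only on the first `n` coordinates. -/
def DependsOnFirst (n : ℕ) (B : Set (ℕ → Bool)) : Prop :=
  ∀ ω ω' : ℕ → Bool, (∀ i < n, ω i = ω' i) → ω ∈ B → ω' ∈ B

lemma occursAt_congr {S : List Bool} {ω ω' : ℕ → Bool} {n : ℕ}
    (h : ∀ i < n, ω i = ω' i) : occursAt S ω n ↔ occursAt S ω' n := by
  unfold occursAt
  refine and_congr_right fun hn => forall₂_congr fun j hj => ?_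
  rw [h _ (by omega)]

lemma dependsOnFirst_firstAt (S : ι → List Bool) (i : ι) (k : ℕ) :
    DependsOnFirst k (firstAt S i k) := by
  rintro ω ω' h ⟨h1, h2⟩
  exact ⟨(occursAt_congr h).1 h1, fun l hl i' h' =>
    h2 l hl i' ((occursAt_congr fun r hr => h r (by omega)).2 h')⟩

lemma dependsOnFirst_survives (S : ι → List Bool) (n : ℕ) :
    DependsOnFirst n (survives S n) := by
  intro ω ω' h h1 l hl i h'
  exact h1 l hl i ((occursAt_congr fun r hr => h r (by omega)).2 h')

/-- Restriction of a sequence to its first `n` coordinates. -/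
def restrictFirst (n : ℕ) (ω : ℕ → Bool) : Fin n → Bool := fun i => ω i

lemma measurable_restrictFirst (n : ℕ) : Measurable (restrictFirst n) :=
  measurable_pi_lambda _ fun _ => measurable_pi_apply _

lemma DependsOnFirst.exists_preimage {n : ℕ} {B : Set (ℕ → Bool)} (hB : DependsOnFirst n B) :
    ∃ s : Finset (Fin n → Bool), B = restrictFirst n ⁻¹' s := by
  classical
  refine ⟨(restrictFirst n '' B).toFinite.toFinset, ?_⟩
  ext ω
  simp only [Set.mem_preimage, Set.Finite.coe_toFinset, Set.mem_image]
  refine ⟨fun h => ⟨ω, h, rfl⟩, ?_⟩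
  rintro ⟨ω', h, h'⟩
  exact hB ω' ω (fun i hi => congrFun h' ⟨i, hi⟩) h

lemma DependsOnFirst.measurableSet {n : ℕ} {B : Set (ℕ → Bool)} (hB : DependsOnFirst n B) :
    MeasurableSet B := by
  obtain ⟨s, rfl⟩ := hB.exists_preimage
  exact measurable_restrictFirst n s.measurableSet

lemma measurableSet_readsAfter (n m : ℕ) (b : ℕ → Bool) : MeasurableSet (readsAfter n m b) := by
  refine DependsOnFirst.measurableSet (n := n + m) ?_
  intro ω ω' h h1 j hj
  rw [← h _ (by omega)]
  exact h1 j hj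

/-- Fair coin tosses after time `n` are independent of the first `n` tosses. -/
lemma measure_inter_readsAfter {μ : Measure (ℕ → Bool)}
    (hμ : ∀ (n : ℕ) (b : ℕ → Bool), μ {ω | ∀ i < n, ω i = b i} = (1 / 2 : ℝ≥0∞) ^ n)
    {n : ℕ} {B : Set (ℕ → Bool)} (hB : DependsOnFirst n B) (m : ℕ) (b : ℕ → Bool) :
    μ (B ∩ readsAfter n m b) = μ B * (1 / 2 : ℝ≥0∞) ^ m := by
  obtain ⟨s, rfl⟩ := hB.exists_preimage
  have hmeas : ∀ v ∈ s, MeasurableSet (restrictFirst n ⁻¹' {v}) := fun v _ =>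
    measurable_restrictFirst n (measurableSet_singleton v)
  have hX := measurableSet_readsAfter n m b
  rw [← Measure.restrict_apply' hX, ← sum_measure_preimage_singleton s hmeas,
    ← sum_measure_preimage_singleton s hmeas, Finset.sum_mul]
  refine Finset.sum_congr rfl fun v _ => ?_
  rw [Measure.restrict_apply' hX]
  let c : ℕ → Bool := fun i => if h : i < n then v ⟨i, h⟩ else b (i - n)
  have h1 : restrictFirst n ⁻¹' {v} = {ω | ∀ i < n, ω i = c i} := by
    ext ω
    simp only [Set.mem_preimage, Set.mem_singleton_iff, Set.mem_ofPred_eq, funext_iff,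
      Fin.forall_iff, restrictFirst, c]
    exact forall₂_congr fun i hi => by simp [hi]
  have h2 : restrictFirst n ⁻¹' {v} ∩ readsAfter n m b = {ω | ∀ i < n + m, ω i = c i} := by
    rw [h1]
    ext ω
    simp only [Set.mem_inter_iff, Set.mem_ofPred_eq, readsAfter]
    constructor
    · rintro ⟨h, h'⟩ i hi
      by_cases hin : i < n
      · exact h i hin
      · have := h' (i - n) (by omega)
        rw [show n + (i - n) = i by omega] at this
        simp [c, hin, this]
    · intro h
      refine ⟨fun i hi => h i (by omega), fun j hj => ?_⟩
      simpa [c] using h (n + j) (by omega)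
  rw [h2, hμ, h1, hμ, pow_add]

/-- All patterns are nonempty and none occurs inside another one. -/
structure Reduced (S : ι → List Bool) : Prop where
  pos : ∀ i, 0 < (S i).length
  eq_of_occursAt : ∀ i i', ∀ k ≤ (S i).length, occursAt (S i') (letters (S i)) k → i = i'

lemma Reduced.eq_of_occursAt_same {S : ι → List Bool} (hS : Reduced S) {ω : ℕ → Bool} {k : ℕ}
    {i i' : ι} (h : occursAt (S i) ω k) (h' : occursAt (S i') ω k) : i = i' := by
  wlog hle : (S i').length ≤ (S i).length generalizing i i'
  · exact (this h' h (by omega)).symm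
  refine hS.eq_of_occursAt i i' _ le_rfl ⟨hle, fun j hj => ?_⟩
  rw [← h'.2 j hj, letters, ← h.2 _ (by omega)]
  have := h.1
  congr 1
  omega

lemma Reduced.eq_of_mem_firstAt {S : ι → List Bool} (hS : Reduced S) {ω : ℕ → Bool} {k k' : ℕ}
    {i i' : ι} (h : ω ∈ firstAt S i k) (h' : ω ∈ firstAt S i' k') : i = i' ∧ k = k' := by
  have hk : k = k' := by
    rcases lt_trichotomy k k' with hlt | heq | hlt
    · exact absurd h.1 (h'.2 k hlt i)
    · exact heq
    · exact absurd h'.1 (h.2 k' hlt i')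
  subst hk
  exact ⟨hS.eq_of_occursAt_same h.1 h'.1, rfl⟩

lemma exists_mem_firstAt {S : ι → List Bool} {ω : ℕ → Bool} {n : ℕ} {i : ι}
    (h : occursAt (S i) ω n) : ∃ k ≤ n, ∃ i', ω ∈ firstAt S i' k := by
  classical
  have hex : ∃ k, ∃ i', occursAt (S i') ω k := ⟨n, i, h⟩
  obtain ⟨i', hi'⟩ := Nat.find_spec hex
  exact ⟨Nat.find hex, Nat.find_min' hex ⟨i, h⟩, i', hi', fun l hl i'' h'' =>
    Nat.find_min hex hl ⟨i'', h''⟩⟩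

lemma occursAt_of_mem_readsAfter {S : List Bool} {ω : ℕ → Bool} {n : ℕ}
    (h : ω ∈ readsAfter n S.length (letters S)) : occursAt S ω (n + S.length) :=
  ⟨by omega, fun j hj => by rw [Nat.add_sub_cancel]; exact h j hj⟩

lemma survives_inter_readsAfter (S : ι → List Bool) (i : ι) (n : ℕ) :
    survives S n ∩ readsAfter n (S i).length (letters (S i)) =
      ⋃ j ∈ Finset.range (S i).length, ⋃ i',
        firstAt S i' (n + (j + 1)) ∩ readsAfter n (S i).length (letters (S i)) := by
  ext ω
  simp only [Set.mem_iUnion, Finset.mem_range, Set.mem_inter_iff, exists_prop]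
  constructor
  · rintro ⟨h, h'⟩
    obtain ⟨k, hk, i', hki⟩ := exists_mem_firstAt (occursAt_of_mem_readsAfter h')
    have hnk : n < k := by
      by_contra! hle
      exact h k hle i' hki.1
    refine ⟨k - n - 1, by omega, i', ?_, h'⟩
    rwa [show n + (k - n - 1 + 1) = k by omega]
  · rintro ⟨j, -, i', h, h'⟩
    exact ⟨fun l hl => h.2 l (by omega), h'⟩

lemma Reduced.firstAt_inter_readsAfter {S : ι → List Bool} (hS : Reduced S) (i i' : ι)
    (n j : ℕ) (hj : j ≤ (S i).length) :
    firstAt S i' (n + j) ∩ readsAfter n (S i).length (letters (S i)) =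
      if Overlaps (S i) (S i') j then
        firstAt S i' (n + j) ∩
          readsAfter (n + j) ((S i).length - j) (fun r => letters (S i) (j + r))
      else ∅ := by
  split_ifs with hov
  · ext ω
    refine and_congr_right fun h => ?_
    constructor
    · intro h' r hr
      rw [add_assoc]
      exact h' _ (by omega)
    · intro h' r hr
      by_cases hrj : r < j
      · have h1 := hov.1
        have h2 := h.1.1
        rw [letters, hov.2 r hrj, ← h.1.2 _ (by omega)]
        congr 1
        omega
      · have := h' (r - j) (by omega)
        dsimp only at this
        rwa [show n + j + (r - j) = n + r by omega, show j + (r - j) = r by omega] at this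
  · rw [Set.eq_empty_iff_forall_notMem]
    rintro ω ⟨h, h'⟩
    have h2 := h.1.1
    by_cases hle : j ≤ (S i').length
    · refine hov ⟨hle, fun r hr => ?_⟩
      rw [← h.1.2 _ (by omega), show n + j - (S i').length + ((S i').length - j + r) = n + r by
        omega]
      exact (h' r (by omega)).symm
    · have heq : i = i' := by
        refine hS.eq_of_occursAt i i' j hj ⟨by omega, fun r hr => ?_⟩
        rw [← h.1.2 r hr, ← h' _ (by omega)]
        congr 1
        omega
      subst heq
      exact hle hj

variable {μ : Measure (ℕ → Bool)} {S : ι → List Bool}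

lemma measurableSet_iUnion_firstAt (S : ι → List Bool) (i : ι) :
    MeasurableSet (⋃ k, firstAt S i k) :=
  MeasurableSet.iUnion fun k => (dependsOnFirst_firstAt S i k).measurableSet

lemma Reduced.tsum_measure_firstAt_add (hS : Reduced S) (i : ι) {j : ℕ}
    (hj : j ≤ (S i).length) :
    ∑' n, μ (firstAt S i (n + j)) = μ (⋃ k, firstAt S i k) := by
  rw [← measure_iUnion]
  · congr 1
    ext ω
    simp only [Set.mem_iUnion]
    constructor
    · rintro ⟨n, h⟩
      exact ⟨_, h⟩
    · rintro ⟨k, h⟩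
      have := h.1.1
      exact ⟨k - j, by rwa [Nat.sub_add_cancel (by omega)]⟩
  · intro n₁ n₂ hne
    rw [Function.onFun, Set.disjoint_left]
    intro ω h₁ h₂
    have := (hS.eq_of_mem_firstAt h₁ h₂).2
    omega
  · exact fun n => (dependsOnFirst_firstAt S i _).measurableSet

variable [Fintype ι]

lemma Reduced.measure_survives_mul
    (hμ : ∀ (n : ℕ) (b : ℕ → Bool), μ {ω | ∀ i < n, ω i = b i} = (1 / 2 : ℝ≥0∞) ^ n)
    (hS : Reduced S) (i : ι) (n : ℕ) :
    μ (survives S n) * (1 / 2 : ℝ≥0∞) ^ (S i).length =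
      ∑ j ∈ Finset.range (S i).length, ∑ i',
        if Overlaps (S i) (S i') (j + 1) then
          μ (firstAt S i' (n + (j + 1))) * (1 / 2 : ℝ≥0∞) ^ ((S i).length - (j + 1))
        else 0 := by
  have hX := measurableSet_readsAfter n (S i).length (letters (S i))
  have hm : ∀ i' j, MeasurableSet
      (firstAt S i' (n + (j + 1)) ∩ readsAfter n (S i).length (letters (S i))) := fun i' j =>
    (dependsOnFirst_firstAt S i' _).measurableSet.inter hX
  rw [← measure_inter_readsAfter hμ (dependsOnFirst_survives S n) _ (letters (S i)),
    survives_inter_readsAfter, measure_biUnion_finset]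
  · refine Finset.sum_congr rfl fun j hj => ?_
    rw [measure_iUnion _ fun i' => hm i' j, tsum_fintype]
    · refine Finset.sum_congr rfl fun i' _ => ?_
      rw [hS.firstAt_inter_readsAfter i i' n (j + 1) (Finset.mem_range.1 hj)]
      split_ifs
      · exact measure_inter_readsAfter hμ (dependsOnFirst_firstAt S i' _) _ _
      · exact measure_empty
    · intro i₁ i₂ hne
      rw [Function.onFun, Set.disjoint_left]
      exact fun ω h₁ h₂ => hne (hS.eq_of_mem_firstAt h₁.1 h₂.1).1
  · intro j₁ _ j₂ _ hne
    rw [Function.onFun, Set.disjoint_left]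
    intro ω h₁ h₂
    simp only [Set.mem_iUnion] at h₁ h₂
    obtain ⟨i₁, h₁⟩ := h₁
    obtain ⟨i₂, h₂⟩ := h₂
    have := (hS.eq_of_mem_firstAt h₁.1 h₂.1).2
    omega
  · exact fun j _ => MeasurableSet.iUnion fun i' => hm i' j

/-- Conway's identity: the expected duration of the game, computed from the overlaps of the
`i`-th pattern with all patterns. -/
lemma Reduced.tsum_measure_survives
    (hμ : ∀ (n : ℕ) (b : ℕ → Bool), μ {ω | ∀ i < n, ω i = b i} = (1 / 2 : ℝ≥0∞) ^ n)
    (hS : Reduced S) (i : ι) :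
    ∑' n, μ (survives S n) =
      ∑ i', (overlapWeight (S i) (S i') : ℝ≥0∞) * μ (⋃ k, firstAt S i' k) := by
  have hhalf : ∀ m : ℕ, (1 / 2 : ℝ≥0∞) ^ m * 2 ^ m = 1 := fun m => by
    rw [← mul_pow, ENNReal.div_mul_cancel two_ne_zero ofNat_ne_top, one_pow]
  have hterm : ∀ n, μ (survives S n) =
      ∑ i', ∑ j ∈ Finset.range (S i).length,
        (if Overlaps (S i) (S i') (j + 1) then (2 : ℝ≥0∞) ^ (j + 1) else 0) *
          μ (firstAt S i' (n + (j + 1))) := fun n => by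
    rw [← mul_one (μ (survives S n)), ← hhalf (S i).length, ← mul_assoc,
      hS.measure_survives_mul hμ, Finset.sum_comm, Finset.sum_mul]
    refine Finset.sum_congr rfl fun i' _ => ?_
    rw [Finset.sum_mul]
    refine Finset.sum_congr rfl fun j hj => ?_
    split_ifs
    · have hj' : (S i).length = ((S i).length - (j + 1)) + (j + 1) := by
        have := Finset.mem_range.1 hj
        omega
      conv_lhs => rw [hj', pow_add, Nat.add_sub_cancel]
      rw [mul_assoc, ← mul_assoc ((1 / 2 : ℝ≥0∞) ^ _), hhalf, one_mul, mul_comm]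
    · simp
  simp_rw [hterm]
  rw [Summable.tsum_finsetSum fun _ _ => ENNReal.summable]
  refine Finset.sum_congr rfl fun i' _ => ?_
  rw [Summable.tsum_finsetSum fun _ _ => ENNReal.summable, overlapWeight, Nat.cast_sum,
    Finset.sum_mul]
  refine Finset.sum_congr rfl fun j _ => ?_
  rw [ENNReal.tsum_mul_left]
  split_ifs with h
  · rw [hS.tsum_measure_firstAt_add i' h.1, Nat.cast_pow, Nat.cast_ofNat]
  · simp

/-- Almost surely, exactly one of the patterns wins. -/
lemma Reduced.sum_measure_iUnion_firstAt [IsProbabilityMeasure μ] [Nonempty ι]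
    (hμ : ∀ (n : ℕ) (b : ℕ → Bool), μ {ω | ∀ i < n, ω i = b i} = (1 / 2 : ℝ≥0∞) ^ n)
    (hS : Reduced S) : ∑ i, μ (⋃ k, firstAt S i k) = 1 := by
  have hfin : ∑' n, μ (survives S n) ≠ ∞ := by
    rw [hS.tsum_measure_survives hμ (Classical.arbitrary ι)]
    exact ENNReal.sum_ne_top.2 fun i' _ => ENNReal.mul_ne_top (natCast_ne_top _)
      (measure_ne_top _ _)
  have hzero : μ (⋂ n, survives S n) = 0 := by
    have hlim := ENNReal.tendsto_atTop_zero_of_tsum_ne_top hfin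
    exact le_antisymm (ge_of_tendsto' hlim fun n => measure_mono (Set.iInter_subset _ n)) zero_le
  have hcompl : (⋃ i, ⋃ k, firstAt S i k)ᶜ ⊆ ⋂ n, survives S n := by
    intro ω h
    refine Set.mem_iInter.2 fun n l _ i hocc => h ?_
    obtain ⟨k, -, i', hk⟩ := exists_mem_firstAt hocc
    exact Set.mem_iUnion₂.2 ⟨i', k, hk⟩
  rw [← tsum_fintype (L := .unconditional ι), ← measure_iUnion _ (measurableSet_iUnion_firstAt S)]
  · exact (prob_compl_eq_zero_iff (MeasurableSet.iUnion (measurableSet_iUnion_firstAt S))).1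
      (measure_mono_null hcompl hzero)
  · intro i₁ i₂ hne
    rw [Function.onFun, Set.disjoint_left]
    intro ω h₁ h₂
    obtain ⟨k₁, h₁⟩ := Set.mem_iUnion.1 h₁
    obtain ⟨k₂, h₂⟩ := Set.mem_iUnion.1 h₂
    exact hne (hS.eq_of_mem_firstAt h₁ h₂).1

end PatternGame

lemma setOf_winsGame_left (S₁ S₂ : List Bool) :
    {ω | winsGame S₁ S₂ ω} = ⋃ k, firstAt ![S₁, S₂] 0 k := by
  ext ω
  simp [winsGame, firstAt, Fin.forall_fin_two]

lemma setOf_winsGame_right (S₁ S₂ : List Bool) :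
    {ω | winsGame S₂ S₁ ω} = ⋃ k, firstAt ![S₁, S₂] 1 k := by
  ext ω
  simp [winsGame, firstAt, Fin.forall_fin_two, and_comm]

theorem stmt13
    (μ : Measure (ℕ → Bool)) [IsProbabilityMeasure μ]
    (hμ : ∀ (n : ℕ) (b : ℕ → Bool),
      μ {ω | ∀ i < n, ω i = b i} = (1 / 2 : ℝ≥0∞) ^ n) :
    μ {ω | winsGame [false, false, false, true, false, false, false]
            [false, false, true, false, false, false, false, true, false] ω}
        = 62 / 71 ∧
    μ {ω | winsGame [false, false, true, false, false, false, false, true, false]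
            [false, false, false, true, false, false, false] ω}
        = 9 / 71 := by
  set S₁ : List Bool := [false, false, false, true, false, false, false]
  set S₂ : List Bool := [false, false, true, false, false, false, false, true, false]
  have hS : Reduced ![S₁, S₂] := ⟨by decide, by decide⟩
  have hsum := hS.sum_measure_iUnion_firstAt hμ
  have h₁ := hS.tsum_measure_survives hμ 0
  have h₂ := hS.tsum_measure_survives hμ 1
  rw [h₁] at h₂
  rw [setOf_winsGame_left, setOf_winsGame_right]
  simp only [Fin.sum_univ_two] at hsum h₂
  have c₁₁ : overlapWeight S₁ S₁ = 142 := by decide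
  have c₁₂ : overlapWeight S₁ S₂ = 34 := by decide
  have c₂₁ : overlapWeight S₂ S₁ = 70 := by decide
  have c₂₂ : overlapWeight S₂ S₂ = 530 := by decide
  simp only [Matrix.cons_val_zero, Matrix.cons_val_one, c₁₁, c₁₂, c₂₁, c₂₂] at h₂
  have hp := measure_ne_top μ (⋃ k, firstAt ![S₁, S₂] 0 k)
  have hq := measure_ne_top μ (⋃ k, firstAt ![S₁, S₂] 1 k)
  generalize μ (⋃ k, firstAt ![S₁, S₂] 0 k) = p at *
  generalize μ (⋃ k, firstAt ![S₁, S₂] 1 k) = q at *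
  lift p to NNReal using hp
  lift q to NNReal using hq
  norm_cast at hsum h₂
  have hsum' : (p : ℝ) + q = 1 := by exact_mod_cast hsum
  have h₂' : (142 : ℝ) * p + 34 * q = 70 * p + 530 * q := by exact_mod_cast h₂
  have hp' : p = 62 / 71 := NNReal.eq (by push_cast; linarith)
  have hq' : q = 9 / 71 := NNReal.eq (by push_cast; linarith)
  subst hp' hq'
  constructor <;> rw [ENNReal.coe_div (by norm_num)] <;> rfl
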